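/- Let x ∈ A be solvable with v_{ρ,σ}(x) ≥ ρ + σ for every pair (ρ,σ) of relatively prime positive integers, and suppose x has adjacent edges E_{ρ₁,σ₁}(x) and E_{ρ₂,σ₂}(x), where (ρ₁,σ₁), (ρ₂,σ₂) are pairs of relatively prime positive integers with ρ₁/σ₁ < ρ₂/σ₂. Suppose that for l = 1, 2 the (ρ_l,σ_l)-polynomial of x equals f_l^{r_l}, where r_l > 1 and f_l ∈ F[X,Y] is not equal to κ^m for any κ ∈ F[X,Y] and any integer m > 1. Then gcd(r₁, r₂) > 1. (Lemma 5.5) -/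

import Mathlib

open scoped BigOperators

/-- Defining relation of the Weyl algebra: `p * q = q * p + 1`. -/
inductive WeylRel (F : Type*) [CommRing F] :
    FreeAlgebra F (Fin 2) → FreeAlgebra F (Fin 2) → Prop
  | comm : WeylRel F (FreeAlgebra.ι F 0 * FreeAlgebra.ι F 1)
      (FreeAlgebra.ι F 1 * FreeAlgebra.ι F 0 + 1)

/-- The Weyl algebra over `F`. -/
abbrev WeylAlgebra (F : Type*) [CommRing F] := RingQuot (WeylRel F)

variable (F : Type*) [Field F] [CharZero F]

/-- The generator `p` of the Weyl algebra. -/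
noncomputable def Wp : WeylAlgebra F :=
  RingQuot.mkAlgHom F (WeylRel F) (FreeAlgebra.ι F 0)

/-- The generator `q` of the Weyl algebra. -/
noncomputable def Wq : WeylAlgebra F :=
  RingQuot.mkAlgHom F (WeylRel F) (FreeAlgebra.ι F 1)

/-- `x` is solvable if `[x, y] = 1` for some `y`. -/
def Solvable (x : WeylAlgebra F) : Prop := ∃ y : WeylAlgebra F, x * y - y * x = 1

/-- The centralizer `C(x)`. -/
def Cset (x : WeylAlgebra F) : Set (WeylAlgebra F) := {y | x * y - y * x = 0}

/-- `N(x) = {y | (ad x)^n y = 0 for some n ≥ 1}`. -/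
def Nset (x : WeylAlgebra F) : Set (WeylAlgebra F) :=
  {y | ∃ n : ℕ, 1 ≤ n ∧ (fun z => x * z - z * x)^[n] y = 0}

/-- `D(x) = {y | [x,y] = λ y for some scalar λ}`. -/
def Dset (x : WeylAlgebra F) : Set (WeylAlgebra F) :=
  {y | ∃ c : F, x * y - y * x = c • y}

def Delta1 : Set (WeylAlgebra F) :=
  {x | x ∉ Set.range (algebraMap F (WeylAlgebra F)) ∧
    Nset F x = Set.univ ∧ Dset F x = Cset F x}

def Delta2 : Set (WeylAlgebra F) :=
  {x | x ∉ Set.range (algebraMap F (WeylAlgebra F)) ∧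
    Nset F x ≠ Set.univ ∧ Nset F x ≠ Cset F x ∧ Dset F x = Cset F x}

/-- The graded component `A_s = {a | [pq, a] = s • a}`. -/
def Wgrade (s : ℤ) : Set (WeylAlgebra F) :=
  {a | (Wp F * Wq F) * a - a * (Wp F * Wq F) = s • a}

/-- The monomial `p^i q^j`. -/
noncomputable def Wmono (i j : ℕ) : WeylAlgebra F := Wp F ^ i * Wq F ^ j

/-- `α` is the coordinate family of `x` in the basis `p^i q^j`. -/
def Represents (α : (ℕ × ℕ) →₀ F) (x : WeylAlgebra F) : Prop :=
  x = α.sum fun ij c => c • Wmono F ij.1 ij.2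

/-- `v_{ρ,σ}(x) = max { iρ + jσ | (i,j) ∈ E(x) }`. -/
def vdeg (α : (ℕ × ℕ) →₀ F) (ρ σ : ℕ) : ℕ :=
  α.support.sup fun ij => ij.1 * ρ + ij.2 * σ

/-- `E_{ρ,σ}(x)`. -/
def Eset (α : (ℕ × ℕ) →₀ F) (ρ σ : ℕ) : Finset (ℕ × ℕ) :=
  α.support.filter fun ij => ij.1 * ρ + ij.2 * σ = vdeg F α ρ σ

/-- The `(ρ,σ)`-polynomial of `x`, an element of `F[X,Y]`. -/
noncomputable def wpoly (α : (ℕ × ℕ) →₀ F) (ρ σ : ℕ) : MvPolynomial (Fin 2) F :=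
  ∑ ij ∈ Eset F α ρ σ,
    MvPolynomial.monomial (Finsupp.single 0 ij.1 + Finsupp.single 1 ij.2) (α ij)

/-- The `(ρ,σ)`-term of `x`, an element of the Weyl algebra. -/
noncomputable def wterm (α : (ℕ × ℕ) →₀ F) (ρ σ : ℕ) : WeylAlgebra F :=
  ∑ ij ∈ Eset F α ρ σ, α ij • Wmono F ij.1 ij.2

section Univariate

open Polynomial

variable {K : Type*} [Field K]

/-- The weighted Wronskian `A p' g - B p g'`. -/
noncomputable def wtWronskian (A B : ℕ) (p g : K[X]) : K[X] :=
  (A : K[X]) * derivative p * g - (B : K[X]) * p * derivative g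

lemma coeff_X_mul_derivative (p : K[X]) (n : ℕ) :
    (X * derivative p).coeff n = n * p.coeff n := by
  cases n with
  | zero => simp
  | succ n => rw [coeff_X_mul, coeff_derivative]; push_cast; ring

lemma natDegree_X_mul_derivative_le (p : K[X]) : (X * derivative p).natDegree ≤ p.natDegree := by
  rw [natDegree_le_iff_coeff_eq_zero]
  intro n hn
  rw [coeff_X_mul_derivative, coeff_eq_zero_of_natDegree_lt hn, mul_zero]

lemma coeff_X_mul_wtWronskian (A B : ℕ) (p g : K[X]) :
    (X * wtWronskian A B p g).coeff (p.natDegree + g.natDegree) =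
      (A * p.natDegree - B * g.natDegree) * (p.leadingCoeff * g.leadingCoeff) := by
  have h : X * wtWronskian A B p g =
      C (A : K) * (X * derivative p * g) - C (B : K) * (p * (X * derivative g)) := by
    simp only [wtWronskian, map_natCast]; ring
  rw [h, coeff_sub, coeff_C_mul, coeff_C_mul,
    coeff_mul_add_eq_of_natDegree_le (natDegree_X_mul_derivative_le p) le_rfl,
    coeff_mul_add_eq_of_natDegree_le le_rfl (natDegree_X_mul_derivative_le g),
    coeff_X_mul_derivative, coeff_X_mul_derivative]
  simp only [leadingCoeff]; ring

/-- Local form of `wtWronskian` at a point `r`. -/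
lemma exists_X_sub_C_mul_wtWronskian (A B e s : ℕ) (r : K) (p g : K[X]) :
    ∃ q : K[X], (X - C r) * wtWronskian A B ((X - C r) ^ e * p) ((X - C r) ^ s * g) =
      (X - C r) ^ (e + s) * q ∧ q.eval r = (A * e - B * s) * (p.eval r * g.eval r) := by
  have key : ∀ (n : ℕ) (f : K[X]), (X - C r) * derivative ((X - C r) ^ n * f) =
      (X - C r) ^ n * ((n : K[X]) * f + (X - C r) * derivative f) := by
    intro n f
    rw [derivative_mul, derivative_X_sub_C_pow]
    cases n with
    | zero => simp
    | succ n => simp only [Nat.add_sub_cancel, map_natCast]; ring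
  refine ⟨(A : K[X]) * ((e : K[X]) * p + (X - C r) * derivative p) * g -
    (B : K[X]) * p * ((s : K[X]) * g + (X - C r) * derivative g), ?_, ?_⟩
  · have h : (X - C r) * wtWronskian A B ((X - C r) ^ e * p) ((X - C r) ^ s * g) =
        (A : K[X]) * ((X - C r) * derivative ((X - C r) ^ e * p)) * ((X - C r) ^ s * g) -
        (B : K[X]) * ((X - C r) ^ e * p) * ((X - C r) * derivative ((X - C r) ^ s * g)) := by
      simp only [wtWronskian]; ring
    rw [h, key, key]; ring
  · simp; ring

lemma exists_eq_X_sub_C_pow_rootMultiplicity_mul {p : K[X]} (hp : p ≠ 0) (r : K) :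
    ∃ q : K[X], p = (X - C r) ^ p.rootMultiplicity r * q ∧ q.eval r ≠ 0 := by
  obtain ⟨q, hq, hr⟩ := exists_eq_pow_rootMultiplicity_mul_and_not_dvd p hp r
  exact ⟨q, hq, fun h => hr (dvd_iff_isRoot.2 h)⟩

lemma mul_rootMultiplicity_of_wtWronskian_eq_zero [CharZero K] {A B : ℕ} {p h : K[X]}
    (hp : p ≠ 0) (hh : h ≠ 0) (H : wtWronskian A B p h = 0) (r : K) :
    A * p.rootMultiplicity r = B * h.rootMultiplicity r := by
  obtain ⟨p₁, hp₁, hpr⟩ := exists_eq_X_sub_C_pow_rootMultiplicity_mul hp r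
  obtain ⟨h₁, hh₁, hhr⟩ := exists_eq_X_sub_C_pow_rootMultiplicity_mul hh r
  obtain ⟨q, hq, hqr⟩ := exists_X_sub_C_mul_wtWronskian A B (p.rootMultiplicity r)
    (h.rootMultiplicity r) r p₁ h₁
  rw [← hp₁, ← hh₁, H, mul_zero, eq_comm, mul_eq_zero_iff_left
    (pow_ne_zero _ (X_sub_C_ne_zero r))] at hq
  rw [hq, eval_zero, eq_comm, mul_eq_zero_iff_right (mul_ne_zero hpr hhr), sub_eq_zero] at hqr
  exact_mod_cast hqr

lemma mul_natDegree_of_wtWronskian_eq_zero [CharZero K] {A B : ℕ} {p h : K[X]}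
    (hp : p ≠ 0) (hh : h ≠ 0) (H : wtWronskian A B p h = 0) :
    A * p.natDegree = B * h.natDegree := by
  have := coeff_X_mul_wtWronskian A B p h
  rw [H, mul_zero, coeff_zero, eq_comm, mul_eq_zero_iff_right
    (mul_ne_zero (leadingCoeff_ne_zero.2 hp) (leadingCoeff_ne_zero.2 hh)), sub_eq_zero] at this
  exact_mod_cast this

lemma rootMultiplicity_le_of_wtWronskian [CharZero K] {s v wG wH : ℕ} {k : K} {p g h : K[X]}
    (hp : p ≠ 0) (hg : g ≠ 0) (hh : h ≠ 0) (hv : 0 < v) (hk : k ≠ 0)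
    (hw : wH + s = wG + v) (hG : wtWronskian wG v p g = C k * h)
    (hH : wtWronskian wH v p h = 0) (r : K) :
    h.rootMultiplicity r ≤ p.rootMultiplicity r + g.rootMultiplicity r := by
  have hmul := mul_rootMultiplicity_of_wtWronskian_eq_zero hp hh hH r
  obtain ⟨p₁, hp₁, hpr⟩ := exists_eq_X_sub_C_pow_rootMultiplicity_mul hp r
  obtain ⟨g₁, hg₁, hgr⟩ := exists_eq_X_sub_C_pow_rootMultiplicity_mul hg r
  obtain ⟨q, hq, hqr⟩ := exists_X_sub_C_mul_wtWronskian wG v (p.rootMultiplicity r)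
    (g.rootMultiplicity r) r p₁ g₁
  rw [← hp₁, ← hg₁, hG] at hq
  by_cases heq : wG * p.rootMultiplicity r = v * g.rootMultiplicity r
  · refine Nat.le_of_mul_le_mul_left (?_ : v * _ ≤ v * _) hv
    rw [← hmul, mul_add, ← heq]
    nlinarith [Nat.zero_le (s * p.rootMultiplicity r)]
  · have hqr0 : q.eval r ≠ 0 := by
      rw [hqr]
      refine mul_ne_zero (sub_ne_zero.2 ?_) (mul_ne_zero hpr hgr)
      exact_mod_cast heq
    have hq0 : q ≠ 0 := by rintro rfl; simp at hqr0
    have hX : X - C r ≠ 0 := X_sub_C_ne_zero r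
    have h1 := congrArg (rootMultiplicity r) hq
    rw [rootMultiplicity_mul (mul_ne_zero hX (mul_ne_zero (C_ne_zero.2 hk) hh)),
      rootMultiplicity_mul (mul_ne_zero (C_ne_zero.2 hk) hh),
      rootMultiplicity_mul (mul_ne_zero (pow_ne_zero _ hX) hq0),
      rootMultiplicity_X_sub_C_self, rootMultiplicity_C, rootMultiplicity_X_sub_C_pow,
      rootMultiplicity_eq_zero hqr0] at h1
    omega

lemma map_wtWronskian {L : Type*} [Field L] (i : K →+* L) (A B : ℕ) (p g : K[X]) :
    (wtWronskian A B p g).map i = wtWronskian A B (p.map i) (g.map i) := by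
  simp [wtWronskian, derivative_map]

/-- If `A p' g - v p g'` is a nonzero multiple of `h`, and `h` is in the kernel of the Wronskian
against `p`, then `h` divides `p * g`. -/
lemma dvd_mul_of_wtWronskian [CharZero K] {s v wG wH : ℕ} {k : K} {p g h : K[X]}
    (hp : p ≠ 0) (hg : g ≠ 0) (hh : h ≠ 0) (hv : 0 < v) (hk : k ≠ 0)
    (hw : wH + s = wG + v) (hG : wtWronskian wG v p g = C k * h)
    (hH : wtWronskian wH v p h = 0) : h ∣ p * g := by
  classical
  let i := algebraMap K (AlgebraicClosure K)
  have hi : Function.Injective i := i.injective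
  rw [← map_dvd_map' i, Polynomial.map_mul]
  have hp' := (Polynomial.map_ne_zero_iff hi).2 hp
  have hg' := (Polynomial.map_ne_zero_iff hi).2 hg
  have hh' := (Polynomial.map_ne_zero_iff hi).2 hh
  have : CharZero (AlgebraicClosure K) := charZero_of_injective_algebraMap hi
  refine (IsAlgClosed.splits _).dvd_of_roots_le_roots hh' (Multiset.le_iff_count.2 fun r => ?_)
  rw [count_roots, count_roots, rootMultiplicity_mul (mul_ne_zero hp' hg')]
  refine rootMultiplicity_le_of_wtWronskian (k := i k) hp' hg' hh' hv
    ((map_ne_zero i).2 hk) hw ?_ ?_ r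
  · rw [← map_wtWronskian, hG]; simp
  · rw [← map_wtWronskian, hH]; simp

/-- The exponents occurring in `p` are the first coordinates of lattice points of weight `w`. -/
def SupportedInWeight (ρ σ w : ℕ) (p : K[X]) : Prop :=
  ∀ i ∈ p.support, ∃ j, i * ρ + j * σ = w

lemma eq_one_of_mod {ρ σ v wG wH a b c d : ℕ} (hco : Nat.Coprime ρ σ)
    (hw : wH + (ρ + σ) = wG + v) (ha : ∃ j, a * ρ + j * σ = v) (hb : ∃ j, b * ρ + j * σ = wG)
    (hc : ∃ j, c * ρ + j * σ = wH) (habc : a + b = c + d) : (σ : ℤ) ∣ d - 1 := by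
  obtain ⟨j₁, h₁⟩ := ha
  obtain ⟨j₂, h₂⟩ := hb
  obtain ⟨j₃, h₃⟩ := hc
  have hco' : IsCoprime (σ : ℤ) ρ := (Nat.isCoprime_iff_coprime.2 hco).symm
  refine hco'.dvd_of_dvd_mul_right ⟨j₃ + 1 - j₁ - j₂, ?_⟩
  zify at *
  have : (d : ℤ) = a + b - c := by linarith
  linear_combination (ρ : ℤ) * this - hw + h₁ + h₂ - h₃

lemma sigma_eq_one_of_wtWronskian [CharZero K] {ρ σ v wG wH : ℕ} {k : K} {p g h : K[X]}
    (hρ : 0 < ρ) (hco : Nat.Coprime ρ σ)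
    (hp : p ≠ 0) (hg : g ≠ 0) (hh : h ≠ 0) (hk : k ≠ 0)
    (hw : wH + (ρ + σ) = wG + v) (hG : wtWronskian wG v p g = C k * h)
    (hH : wtWronskian wH v p h = 0)
    (hpw : SupportedInWeight ρ σ v p) (hgw : SupportedInWeight ρ σ wG g)
    (hhw : SupportedInWeight ρ σ wH h) (hdeg : p.natDegree * ρ < v)
    (hmono : 1 < p.support.card) : σ = 1 := by
  have hv : 0 < v := by omega
  obtain ⟨f, hf⟩ := dvd_mul_of_wtWronskian hp hg hh hv hk hw hG hH
  have hf0 : f ≠ 0 := by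
    rintro rfl
    simp [hp, hg] at hf
  have hode : wtWronskian (ρ + σ) v p f = C k * p := by
    refine mul_left_cancel₀ hh ?_
    have hd := congrArg derivative hf
    rw [derivative_mul, derivative_mul] at hd
    simp only [wtWronskian] at *
    have hw' : (wH : K[X]) + ((ρ + σ : ℕ) : K[X]) = wG + v := by exact_mod_cast hw
    have e1 : ((ρ + σ : ℕ) : K[X]) = wG + v - wH := by linear_combination hw'
    rw [e1]
    linear_combination p * hG + v * p * hd - f * hH
      - ((wG + v - wH) * derivative p) * hf - wH * derivative p * hf
  have hmem : ∀ {q : K[X]}, q ≠ 0 → q.natDegree ∈ q.support := fun hq =>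
    natDegree_mem_support_of_nonzero hq
  have hD : (σ : ℤ) ∣ f.natDegree - 1 := by
    refine eq_one_of_mod hco hw (hpw _ (hmem hp)) (hgw _ (hmem hg)) (hhw _ (hmem hh)) ?_
    rw [← natDegree_mul hp hg, hf, natDegree_mul hh hf0]
  have ht : (σ : ℤ) ∣ f.natTrailingDegree - 1 := by
    refine eq_one_of_mod hco hw (hpw _ (natTrailingDegree_mem_support_of_nonzero hp))
      (hgw _ (natTrailingDegree_mem_support_of_nonzero hg))
      (hhw _ (natTrailingDegree_mem_support_of_nonzero hh)) ?_
    rw [← natTrailingDegree_mul hp hg, hf, natTrailingDegree_mul hh hf0]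
  have hunit : (σ : ℤ) ∣ (0 : ℕ) - 1 → σ = 1 := by
    intro h
    have h2 : (σ : ℤ) ∣ 1 := by simpa using h
    exact_mod_cast Int.eq_one_of_dvd_one (by positivity) h2
  by_contra hσ1
  have ht0 : f.natTrailingDegree ≠ 0 := fun h => hσ1 (hunit (h ▸ ht))
  have htD := natTrailingDegree_le_natDegree f
  have hD1 : f.natDegree = 1 := by
    by_contra hne
    have hc := coeff_X_mul_wtWronskian (ρ + σ) v p f
    rw [hode, ← mul_assoc, mul_comm X, mul_assoc, coeff_C_mul,
      show p.natDegree + f.natDegree = (p.natDegree + (f.natDegree - 1)) + 1 by omega,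
      coeff_X_mul, coeff_eq_zero_of_natDegree_lt (by omega), mul_zero, eq_comm,
      mul_eq_zero_iff_right (mul_ne_zero (leadingCoeff_ne_zero.2 hp) (leadingCoeff_ne_zero.2 hf0)),
      sub_eq_zero] at hc
    have hc' : (ρ + σ) * p.natDegree = v * f.natDegree := by exact_mod_cast hc
    have h1 : f.natDegree * ρ < ρ + σ := by
      rcases Nat.eq_zero_or_pos p.natDegree with h0 | h0
      · rw [h0, mul_zero] at hc'
        have := Nat.mul_pos hv (show 0 < f.natDegree by omega)
        omega
      · have h2 : p.natDegree * ρ * f.natDegree < v * f.natDegree :=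
          Nat.mul_lt_mul_of_pos_right hdeg (by omega)
        rw [← hc'] at h2
        nlinarith
    have h3 : (σ : ℤ) ≤ f.natDegree - 1 := Int.le_of_dvd (by omega) hD
    have h4 : σ + 1 ≤ f.natDegree := by omega
    nlinarith
  have hfX : f = C (f.coeff 1) * X := by
    have h0 : f.coeff 0 = 0 := coeff_eq_zero_of_lt_natTrailingDegree (by omega)
    conv_lhs => rw [eq_X_add_C_of_natDegree_le_one hD1.le, h0]
    simp
  set c := f.coeff 1 with hc
  have hc0 : c ≠ 0 := by
    rw [hc, ← hD1]
    exact leadingCoeff_ne_zero.2 hf0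
  have hco' : ∀ i ∈ p.support, ((ρ + σ : ℕ) : K) * c * i = v * c + k := by
    intro i hi
    have h1 : C (((ρ + σ : ℕ) : K) * c) * (X * derivative p) = C (v * c + k) * p := by
      rw [hfX] at hode
      simp only [wtWronskian, derivative_mul, derivative_C, derivative_X, zero_mul, zero_add,
        mul_one] at hode
      simp only [map_add, map_mul, map_natCast]
      linear_combination hode
    have h2 := congrArg (fun q => q.coeff i) h1
    simp only [coeff_C_mul, coeff_X_mul_derivative] at h2
    have h3 := mem_support_iff.1 hi
    refine mul_right_cancel₀ h3 ?_
    linear_combination h2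
  obtain ⟨i, hi, j, hj, hij⟩ := Finset.one_lt_card.1 hmono
  have h1 := (hco' i hi).trans (hco' j hj).symm
  have h2 : ((ρ + σ : ℕ) : K) * c ≠ 0 := mul_ne_zero (Nat.cast_ne_zero.2 (by omega)) hc0
  exact hij (by exact_mod_cast mul_left_cancel₀ h2 h1)

end Univariate

section WeightFiltration

open MvPolynomial

variable {K : Type*} [Field K]

/-- The polynomials all of whose monomials `X^i Y^j` satisfy `iρ + jσ ≤ n`. -/
noncomputable def weightFil (K : Type*) [Field K] (ρ σ : ℕ) (n : ℤ) :
    Submodule K (MvPolynomial (Fin 2) K) :=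
  restrictSupport K {d | ((d 0 * ρ + d 1 * σ : ℕ) : ℤ) ≤ n}

lemma mem_weightFil {ρ σ : ℕ} {n : ℤ} {f : MvPolynomial (Fin 2) K} :
    f ∈ weightFil K ρ σ n ↔ ∀ d ∈ f.support, ((d 0 * ρ + d 1 * σ : ℕ) : ℤ) ≤ n :=
  Iff.rfl

lemma monomial_mem_weightFil {ρ σ : ℕ} {n : ℤ} {d : Fin 2 →₀ ℕ} (c : K)
    (h : ((d 0 * ρ + d 1 * σ : ℕ) : ℤ) ≤ n) : monomial d c ∈ weightFil K ρ σ n := by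
  rw [mem_weightFil]
  intro e he
  rw [Finset.mem_singleton.1 (support_monomial_subset he)]
  exact h

lemma weightFil_mono {ρ σ : ℕ} {m n : ℤ} (h : m ≤ n) : weightFil K ρ σ m ≤ weightFil K ρ σ n :=
  fun _ hf _ hd => (hf hd).trans h

lemma weightFil_induction {ρ σ : ℕ} {n : ℤ} {P : MvPolynomial (Fin 2) K → Prop}
    (h0 : P 0) (hadd : ∀ f g, P f → P g → P (f + g))
    (hmono : ∀ (d : Fin 2 →₀ ℕ) (c : K), ((d 0 * ρ + d 1 * σ : ℕ) : ℤ) ≤ n → P (monomial d c))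
    {f : MvPolynomial (Fin 2) K} (hf : f ∈ weightFil K ρ σ n) : P f := by
  rw [f.as_sum]
  exact Finset.sum_induction _ P hadd h0 fun d hd => hmono d _ (hf hd)

lemma mul_mem_weightFil {ρ σ : ℕ} {m n : ℤ} {f g : MvPolynomial (Fin 2) K}
    (hf : f ∈ weightFil K ρ σ m) (hg : g ∈ weightFil K ρ σ n) :
    f * g ∈ weightFil K ρ σ (m + n) := by
  refine weightFil_induction (P := fun f => f * g ∈ weightFil K ρ σ (m + n)) (by simp)
    (fun f₁ f₂ h₁ h₂ => by rw [add_mul]; exact add_mem h₁ h₂) (fun d c hd => ?_) hf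
  refine weightFil_induction (P := fun g => monomial d c * g ∈ weightFil K ρ σ (m + n)) (by simp)
    (fun f₁ f₂ h₁ h₂ => by rw [mul_add]; exact add_mem h₁ h₂) (fun e c' he => ?_) hg
  rw [monomial_mul]
  refine monomial_mem_weightFil _ ?_
  simp only [Finsupp.add_apply]
  push_cast at *
  linarith

lemma X_one_mem_weightFil (ρ σ : ℕ) : (X 1 : MvPolynomial (Fin 2) K) ∈ weightFil K ρ σ σ :=
  monomial_mem_weightFil _ (by simp)

lemma pderiv_zero_mem_weightFil {ρ σ : ℕ} {n : ℤ} {f : MvPolynomial (Fin 2) K}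
    (hf : f ∈ weightFil K ρ σ n) : pderiv 0 f ∈ weightFil K ρ σ (n - ρ) := by
  refine weightFil_induction (P := fun f => pderiv 0 f ∈ weightFil K ρ σ (n - ρ)) (by simp)
    (fun f₁ f₂ h₁ h₂ => by rw [map_add]; exact add_mem h₁ h₂) (fun d c hd => ?_) hf
  rw [pderiv_monomial]
  rcases Nat.eq_zero_or_pos (d 0) with h | h
  · simp [h]
  · refine monomial_mem_weightFil _ ?_
    obtain ⟨k, hk⟩ := Nat.exists_eq_add_of_lt h
    simp [hk] at hd ⊢
    linarith

lemma pderiv_one_mem_weightFil {ρ σ : ℕ} {n : ℤ} {f : MvPolynomial (Fin 2) K}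
    (hf : f ∈ weightFil K ρ σ n) : pderiv 1 f ∈ weightFil K ρ σ (n - σ) := by
  refine weightFil_induction (P := fun f => pderiv 1 f ∈ weightFil K ρ σ (n - σ)) (by simp)
    (fun f₁ f₂ h₁ h₂ => by rw [map_add]; exact add_mem h₁ h₂) (fun d c hd => ?_) hf
  rw [pderiv_monomial]
  rcases Nat.eq_zero_or_pos (d 1) with h | h
  · simp [h]
  · refine monomial_mem_weightFil _ ?_
    obtain ⟨k, hk⟩ := Nat.exists_eq_add_of_lt h
    simp [hk] at hd ⊢
    linarith

/-- The part of weight `n` of a polynomial, dehomogenized by setting the second variable to `1`. -/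
noncomputable def topPart (K : Type*) [Field K] (ρ σ : ℕ) (n : ℤ) :
    MvPolynomial (Fin 2) K →ₗ[K] Polynomial K :=
  (basisMonomials (Fin 2) K).constr K fun d =>
    if ((d 0 * ρ + d 1 * σ : ℕ) : ℤ) = n then Polynomial.X ^ d 0 else 0

lemma topPart_monomial (ρ σ : ℕ) (n : ℤ) (d : Fin 2 →₀ ℕ) (c : K) :
    topPart K ρ σ n (monomial d c) =
      if ((d 0 * ρ + d 1 * σ : ℕ) : ℤ) = n then Polynomial.monomial (d 0) c else 0 := by
  have h : monomial d c = c • basisMonomials (Fin 2) K d := by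
    rw [coe_basisMonomials, smul_monomial, smul_eq_mul, mul_one]
  rw [h, map_smul, topPart, Module.Basis.constr_basis]
  split_ifs
  · rw [Polynomial.smul_eq_C_mul, Polynomial.C_mul_X_pow_eq_monomial]
  · simp

lemma coeff_topPart {ρ σ : ℕ} (hσ : 0 < σ) {n : ℤ} (f : MvPolynomial (Fin 2) K) {d : Fin 2 →₀ ℕ}
    (hd : ((d 0 * ρ + d 1 * σ : ℕ) : ℤ) = n) : (topPart K ρ σ n f).coeff (d 0) = coeff d f := by
  induction f using MvPolynomial.induction_on' with
  | monomial e c =>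
    rw [topPart_monomial, coeff_monomial]
    by_cases hed : e = d
    · rw [hed, if_pos hd, if_pos rfl, Polynomial.coeff_monomial_same]
    · rw [if_neg hed]
      split_ifs with h
      · refine Polynomial.coeff_monomial_of_ne _ fun h0 => hed ?_
        ext i
        fin_cases i
        · exact h0.symm
        · have h1 := h.trans hd.symm
          norm_cast at h1
          rw [h0] at h1
          exact Nat.eq_of_mul_eq_mul_right hσ (Nat.add_left_cancel h1)
      · simp
  | add f g hf hg => rw [map_add, Polynomial.coeff_add, hf, hg, coeff_add]

lemma topPart_eq_zero {ρ σ : ℕ} {m n : ℤ} (hmn : m < n) {f : MvPolynomial (Fin 2) K}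
    (hf : f ∈ weightFil K ρ σ m) : topPart K ρ σ n f = 0 := by
  refine weightFil_induction (P := fun f => topPart K ρ σ n f = 0) (by simp)
    (fun f g h₁ h₂ => by rw [map_add, h₁, h₂, add_zero]) (fun d c hd => ?_) hf
  rw [topPart_monomial, if_neg (by omega)]

lemma exists_of_mem_support_topPart {ρ σ : ℕ} {n : ℤ} {f : MvPolynomial (Fin 2) K} {i : ℕ}
    (hi : i ∈ (topPart K ρ σ n f).support) :
    ∃ d ∈ f.support, d 0 = i ∧ ((d 0 * ρ + d 1 * σ : ℕ) : ℤ) = n := by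
  rw [f.as_sum, map_sum, Polynomial.mem_support_iff, Polynomial.finsetSum_coeff] at hi
  obtain ⟨d, hd, h⟩ := Finset.exists_ne_zero_of_sum_ne_zero hi
  rw [topPart_monomial] at h
  split_ifs at h with hn
  · refine ⟨d, hd, ?_, hn⟩
    by_contra hne
    exact h (Polynomial.coeff_monomial_of_ne _ (Ne.symm hne))
  · simp at h

lemma topPart_X_zero_mul (ρ σ : ℕ) (n : ℤ) (f : MvPolynomial (Fin 2) K) :
    topPart K ρ σ (n + ρ) (X 0 * f) = Polynomial.X * topPart K ρ σ n f := by
  induction f using MvPolynomial.induction_on' with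
  | monomial e c =>
    rw [X, monomial_mul, topPart_monomial, topPart_monomial]
    have : (((((Finsupp.single 0 1 + e : Fin 2 →₀ ℕ) 0) * ρ +
      ((Finsupp.single 0 1 + e : Fin 2 →₀ ℕ) 1) * σ : ℕ) : ℤ) = n + ρ) ↔
      ((e 0 * ρ + e 1 * σ : ℕ) : ℤ) = n := by
      simp
      constructor <;> intro h <;> linarith
    simp only [this]
    split_ifs
    · simp [Polynomial.X_mul_monomial, add_comm]
    · simp
  | add f g hf hg => rw [mul_add, map_add, hf, hg, map_add, mul_add]

lemma topPart_X_one_mul (ρ σ : ℕ) (n : ℤ) (f : MvPolynomial (Fin 2) K) :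
    topPart K ρ σ (n + σ) (X 1 * f) = topPart K ρ σ n f := by
  induction f using MvPolynomial.induction_on' with
  | monomial e c =>
    rw [X, monomial_mul, topPart_monomial, topPart_monomial]
    have : (((((Finsupp.single 1 1 + e : Fin 2 →₀ ℕ) 0) * ρ +
      ((Finsupp.single 1 1 + e : Fin 2 →₀ ℕ) 1) * σ : ℕ) : ℤ) = n + σ) ↔
      ((e 0 * ρ + e 1 * σ : ℕ) : ℤ) = n := by
      simp
      constructor <;> intro h <;> linarith
    simp only [this]
    split_ifs
    · simp
    · simp
  | add f g hf hg => rw [mul_add, map_add, hf, hg, map_add]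

/-- The Poisson bracket on `K[X, Y]`, normalized by `{X, Y} = 1`. -/
noncomputable def poisson (f g : MvPolynomial (Fin 2) K) : MvPolynomial (Fin 2) K :=
  pderiv 0 f * pderiv 1 g - pderiv 1 f * pderiv 0 g

lemma topPart_poisson {ρ σ m n : ℕ} {f g : MvPolynomial (Fin 2) K}
    (hf : f ∈ weightFil K ρ σ m) (hg : g ∈ weightFil K ρ σ n) :
    Polynomial.C (σ : K) * topPart K ρ σ (m + n - ρ - σ) (poisson f g) =
      (n : Polynomial K) * Polynomial.derivative (topPart K ρ σ m f) * topPart K ρ σ n g -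
      (m : Polynomial K) * topPart K ρ σ m f * Polynomial.derivative (topPart K ρ σ n g) := by
  refine weightFil_induction (P := fun f => Polynomial.C (σ : K) *
      topPart K ρ σ (m + n - ρ - σ) (poisson f g) =
      (n : Polynomial K) * Polynomial.derivative (topPart K ρ σ m f) * topPart K ρ σ n g -
      (m : Polynomial K) * topPart K ρ σ m f * Polynomial.derivative (topPart K ρ σ n g))
      (by simp [poisson]) (fun f₁ f₂ h₁ h₂ => ?_) (fun d c hd => ?_) hf
  · have : poisson (f₁ + f₂) g = poisson f₁ g + poisson f₂ g := by
      simp only [poisson, map_add]; ring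
    rw [this, map_add, mul_add, h₁, h₂]
    simp only [map_add]; ring
  refine weightFil_induction (P := fun g => Polynomial.C (σ : K) *
      topPart K ρ σ (m + n - ρ - σ) (poisson (monomial d c) g) =
      (n : Polynomial K) * Polynomial.derivative (topPart K ρ σ m (monomial d c)) *
        topPart K ρ σ n g -
      (m : Polynomial K) * topPart K ρ σ m (monomial d c) *
        Polynomial.derivative (topPart K ρ σ n g))
      (by simp [poisson]) (fun f₁ f₂ h₁ h₂ => ?_) (fun e b he => ?_) hg
  · have : poisson (monomial d c) (f₁ + f₂) =
        poisson (monomial d c) f₁ + poisson (monomial d c) f₂ := by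
      simp only [poisson, map_add]; ring
    rw [this, map_add, mul_add, h₁, h₂]
    simp only [map_add]; ring
  refine mul_left_cancel₀ (Polynomial.X_ne_zero) ?_
  have key : X 0 * (X 1 * poisson (monomial d c) (monomial e b)) =
      monomial (d + e) (((d 0 : K) * e 1 - d 1 * e 0) * (c * b)) := by
    have h : X 0 * (X 1 * poisson (monomial d c) (monomial e b)) =
        (X 0 * pderiv 0 (monomial d c)) * (X 1 * pderiv 1 (monomial e b)) -
        (X 1 * pderiv 1 (monomial d c)) * (X 0 * pderiv 0 (monomial e b)) := by
      simp only [poisson]; ring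
    rw [h]
    simp only [X_mul_pderiv_monomial, smul_monomial, monomial_mul, ← map_sub]
    congr 1
    simp only [nsmul_eq_mul]; ring
  have lhs : Polynomial.X * (Polynomial.C (σ : K) *
      topPart K ρ σ (m + n - ρ - σ) (poisson (monomial d c) (monomial e b))) =
      Polynomial.C (σ : K) * topPart K ρ σ (m + n) (monomial (d + e)
        (((d 0 : K) * e 1 - d 1 * e 0) * (c * b))) := by
    rw [← key, show ((m : ℤ) + n) = m + n - ρ - σ + σ + ρ by ring, topPart_X_zero_mul,
      topPart_X_one_mul, show ((m : ℤ) + n - ρ - σ + σ + ρ - ρ - σ) = m + n - ρ - σ by ring]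
    ring
  rw [lhs]
  simp only [topPart_monomial]
  by_cases h1 : ((d 0 * ρ + d 1 * σ : ℕ) : ℤ) = m
  · by_cases h2 : ((e 0 * ρ + e 1 * σ : ℕ) : ℤ) = n
    · have h3 : (((d + e) 0 * ρ + (d + e) 1 * σ : ℕ) : ℤ) = m + n := by
        rw [← h1, ← h2]; simp only [Finsupp.add_apply]; push_cast; ring
      rw [if_pos h1, if_pos h2, if_pos h3]
      have hX : ∀ (k : ℕ) (a : K), Polynomial.X * Polynomial.derivative (Polynomial.monomial k a) =
          (k : Polynomial K) * Polynomial.monomial k a := by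
        intro k a
        rw [Polynomial.derivative_monomial, Polynomial.X_mul_monomial]
        cases k with
        | zero => simp
        | succ k =>
          rw [Nat.add_sub_cancel, ← Polynomial.C_mul_X_pow_eq_monomial,
            ← Polynomial.C_mul_X_pow_eq_monomial]
          simp only [map_mul, map_natCast]; ring
      have hr : ∀ p q : Polynomial K, Polynomial.X * ((n : Polynomial K) *
          Polynomial.derivative p * q - (m : Polynomial K) * p * Polynomial.derivative q) =
          (n : Polynomial K) * (Polynomial.X * Polynomial.derivative p) * q -
          (m : Polynomial K) * p * (Polynomial.X * Polynomial.derivative q) := by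
        intro p q; ring
      rw [hr, hX, hX]
      have h1' : (m : K) = d 0 * ρ + d 1 * σ := by
        have : m = d 0 * ρ + d 1 * σ := by exact_mod_cast h1.symm
        rw [this]; push_cast; rfl
      have h2' : (n : K) = e 0 * ρ + e 1 * σ := by
        have : n = e 0 * ρ + e 1 * σ := by exact_mod_cast h2.symm
        rw [this]; push_cast; rfl
      simp only [← Polynomial.C_mul_X_pow_eq_monomial, ← map_natCast (Polynomial.C (R := K)),
        h1', h2', Finsupp.add_apply]
      simp only [map_mul, map_add, map_sub]
      ring
    · rw [if_neg h2, if_neg]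
      · simp
      · simp only [Finsupp.add_apply]; push_cast at *; intro h; apply h2; linarith
  · rw [if_neg h1, if_neg]
    · simp
    · simp only [Finsupp.add_apply]; push_cast at *; intro h; apply h1; linarith

end WeightFiltration

section WeylSymbol

open MvPolynomial

variable {K : Type*} [Field K]

lemma Wp_mul_Wq : Wp K * Wq K = Wq K * Wp K + 1 := by
  have h := RingQuot.mkAlgHom_rel K (WeylRel.comm (F := K))
  unfold Wp Wq
  simpa only [map_mul, map_add, map_one] using h

/-- The action of `q` on `K[X, Y]` (where `X^i Y^j` stands for `p^i q^j`) by left multiplication. -/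
noncomputable def qAction (K : Type*) [Field K] : Module.End K (MvPolynomial (Fin 2) K) :=
  LinearMap.mulLeft K (X 1) - (pderiv 0).toLinearMap

lemma qAction_apply (f : MvPolynomial (Fin 2) K) : qAction K f = X 1 * f - pderiv 0 f := rfl

/-- The left regular representation of the Weyl algebra, in the basis `p^i q^j`. -/
noncomputable def weylRep (K : Type*) [Field K] : WeylAlgebra K →ₐ[K] Module.End K (MvPolynomial (Fin 2) K) :=
  RingQuot.liftAlgHom K ⟨FreeAlgebra.lift K ![LinearMap.mulLeft K (X 0), qAction K], by
    rintro _ _ ⟨⟩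
    ext1
    simp [qAction]
    ext1
    simp
    ring⟩

lemma weylRep_Wp (f : MvPolynomial (Fin 2) K) : weylRep K (Wp K) f = X 0 * f := by
  rw [weylRep, Wp, RingQuot.liftAlgHom_mkAlgHom_apply, FreeAlgebra.lift_ι_apply]
  rfl

lemma weylRep_Wq : weylRep K (Wq K) = qAction K := by
  rw [weylRep, Wq, RingQuot.liftAlgHom_mkAlgHom_apply, FreeAlgebra.lift_ι_apply]
  rfl

/-- The coordinates of an element of the Weyl algebra, as a polynomial: `p^i q^j ↦ X^i Y^j`. -/
noncomputable def weylSymbol (K : Type*) [Field K] : WeylAlgebra K →ₗ[K] MvPolynomial (Fin 2) K :=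
  (LinearMap.applyₗ 1).comp (weylRep K).toLinearMap

lemma weylSymbol_apply (z : WeylAlgebra K) : weylSymbol K z = weylRep K z 1 := rfl

lemma weylSymbol_mul (y z : WeylAlgebra K) :
    weylSymbol K (y * z) = weylRep K y (weylSymbol K z) := by
  simp [weylSymbol_apply]

lemma weylRep_Wp_pow (i : ℕ) (f : MvPolynomial (Fin 2) K) :
    weylRep K (Wp K ^ i) f = X 0 ^ i * f := by
  induction i with
  | zero => simp
  | succ i ih => rw [pow_succ', map_mul, Module.End.mul_apply, ih, weylRep_Wp, pow_succ']; ring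

lemma weylSymbol_Wq_pow (j : ℕ) : weylSymbol K (Wq K ^ j) = X 1 ^ j := by
  induction j with
  | zero => simp [weylSymbol_apply]
  | succ j ih =>
    rw [pow_succ', weylSymbol_mul, ih, weylRep_Wq, qAction_apply, pow_succ']
    simp

lemma weylSymbol_Wmono (i j : ℕ) :
    weylSymbol K (Wmono K i j) =
      monomial (Finsupp.single 0 i + Finsupp.single 1 j) (1 : K) := by
  rw [Wmono, weylSymbol_mul, weylSymbol_Wq_pow, weylRep_Wp_pow, X_pow_eq_monomial,
    X_pow_eq_monomial, monomial_mul, one_mul]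

/-- The inverse of `weylSymbol`: `X^i Y^j ↦ p^i q^j`. -/
noncomputable def ofSymbol (K : Type*) [Field K] : MvPolynomial (Fin 2) K →ₗ[K] WeylAlgebra K :=
  (basisMonomials (Fin 2) K).constr K fun d => Wmono K (d 0) (d 1)

lemma ofSymbol_monomial (d : Fin 2 →₀ ℕ) (c : K) :
    ofSymbol K (monomial d c) = c • Wmono K (d 0) (d 1) := by
  have h : monomial d c = c • basisMonomials (Fin 2) K d := by
    rw [coe_basisMonomials, smul_monomial, smul_eq_mul, mul_one]
  rw [h, map_smul, ofSymbol, Module.Basis.constr_basis]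

lemma Wq_mul_Wp_pow (i : ℕ) :
    Wq K * Wp K ^ i = Wp K ^ i * Wq K - (i : K) • Wp K ^ (i - 1) := by
  induction i with
  | zero => simp
  | succ i ih =>
    have h : Wq K * Wp K = Wp K * Wq K - 1 := by rw [Wp_mul_Wq]; simp
    have h2 : Wp K * ((i : K) • Wp K ^ (i - 1)) = (i : K) • Wp K ^ i := by
      cases i with
      | zero => simp
      | succ i => rw [mul_smul_comm, Nat.add_sub_cancel, pow_succ']
    rw [pow_succ', ← mul_assoc, h, sub_mul, mul_assoc, ih, mul_sub, h2, Nat.add_sub_cancel]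
    push_cast
    rw [add_smul, one_smul, one_mul, mul_assoc]
    abel

lemma mul_ofSymbol (z : WeylAlgebra K) (f : MvPolynomial (Fin 2) K) :
    z * ofSymbol K f = ofSymbol K (weylRep K z f) := by
  obtain ⟨a, rfl⟩ := RingQuot.mkAlgHom_surjective K (WeylRel K) z
  induction a using FreeAlgebra.induction generalizing f with
  | grade0 r =>
    rw [AlgHom.commutes, AlgHom.commutes, Module.algebraMap_end_apply, map_smul, Algebra.smul_def]
  | mul a b ha hb => rw [map_mul, mul_assoc, hb, ha, map_mul, Module.End.mul_apply]
  | add a b ha hb => rw [map_add, add_mul, ha, hb, map_add, LinearMap.add_apply, map_add]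
  | grade1 i =>
    induction f using MvPolynomial.induction_on' with
    | add f g hf hg => simp only [map_add, mul_add, hf, hg]
    | monomial d c =>
      fin_cases i
      · change Wp K * _ = ofSymbol K (weylRep K (Wp K) _)
        rw [weylRep_Wp, X, monomial_mul, ofSymbol_monomial, ofSymbol_monomial, one_mul,
          mul_smul_comm]
        simp [Wmono, pow_add, mul_assoc]
      · change Wq K * _ = ofSymbol K (weylRep K (Wq K) _)
        rw [weylRep_Wq, qAction_apply, X, monomial_mul, pderiv_monomial, map_sub,
          ofSymbol_monomial, ofSymbol_monomial, ofSymbol_monomial, one_mul, mul_smul_comm]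
        simp [Wmono, pow_add, ← mul_assoc, Wq_mul_Wp_pow, sub_mul, smul_sub, mul_smul]

lemma ofSymbol_weylSymbol (z : WeylAlgebra K) : ofSymbol K (weylSymbol K z) = z := by
  have h : ofSymbol K 1 = 1 := by
    rw [← C_1, C_apply, ofSymbol_monomial]; simp [Wmono]
  rw [weylSymbol_apply, ← mul_ofSymbol, h, mul_one]

lemma weylSymbol_ne_zero {z : WeylAlgebra K} (hz : z ≠ 0) : weylSymbol K z ≠ 0 := fun h =>
  hz (by rw [← ofSymbol_weylSymbol z, h, map_zero])

lemma qAction_mem_weightFil {ρ σ : ℕ} {n : ℤ} {f : MvPolynomial (Fin 2) K}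
    (hf : f ∈ weightFil K ρ σ n) : qAction K f ∈ weightFil K ρ σ (n + σ) := by
  rw [qAction_apply, add_comm]
  exact sub_mem (mul_mem_weightFil (X_one_mem_weightFil ρ σ) hf)
    (weightFil_mono (by omega) (pderiv_zero_mem_weightFil hf))

lemma X_one_pow_mem_weightFil (ρ σ j : ℕ) :
    (X 1 ^ j : MvPolynomial (Fin 2) K) ∈ weightFil K ρ σ (j * σ) := by
  rw [X_pow_eq_monomial]
  exact monomial_mem_weightFil _ (by simp)

lemma X_zero_pow_mem_weightFil (ρ σ j : ℕ) :
    (X 0 ^ j : MvPolynomial (Fin 2) K) ∈ weightFil K ρ σ (j * ρ) := by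
  rw [X_pow_eq_monomial]
  exact monomial_mem_weightFil _ (by simp)

lemma qAction_pow_sub_mem_weightFil {ρ σ : ℕ} {n : ℤ} (j : ℕ) {g : MvPolynomial (Fin 2) K}
    (hg : g ∈ weightFil K ρ σ n) :
    (qAction K ^ j) g - X 1 ^ j * g + pderiv 1 (X 1 ^ j) * pderiv 0 g ∈
      weightFil K ρ σ (j * σ + n - 2 * (ρ + σ)) := by
  induction j with
  | zero => simp
  | succ j ih =>
    set r := (qAction K ^ j) g - X 1 ^ j * g + pderiv 1 (X 1 ^ j) * pderiv 0 g with hr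
    have hq : (qAction K ^ j) g = r + X 1 ^ j * g - pderiv 1 (X 1 ^ j) * pderiv 0 g := by
      rw [hr]; ring
    have h0 : pderiv 0 (X 1 ^ j : MvPolynomial (Fin 2) K) = 0 := by
      simp
    have h01 : pderiv 0 (pderiv 1 (X 1 ^ j) : MvPolynomial (Fin 2) K) = 0 := by
      simp
    have h1 : pderiv 1 (X 1 ^ (j + 1) : MvPolynomial (Fin 2) K) =
        X 1 * pderiv 1 (X 1 ^ j) + X 1 ^ j := by
      rw [pow_succ', Derivation.leibniz, pderiv_X_self]; simp
    have e : (qAction K ^ (j + 1)) g - X 1 ^ (j + 1) * g +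
        pderiv 1 (X 1 ^ (j + 1)) * pderiv 0 g =
        qAction K r + pderiv 1 (X 1 ^ j) * pderiv 0 (pderiv 0 g) := by
      rw [pow_succ', Module.End.mul_apply, hq]
      simp only [qAction_apply, map_add, map_sub, Derivation.leibniz, h0, h01, h1, smul_eq_mul]
      ring
    rw [e]
    refine add_mem (weightFil_mono ?_ (qAction_mem_weightFil ih)) (weightFil_mono ?_
      (mul_mem_weightFil (pderiv_one_mem_weightFil (X_one_pow_mem_weightFil ρ σ j))
        (pderiv_zero_mem_weightFil (pderiv_zero_mem_weightFil hg))))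
    · push_cast; linarith
    · push_cast; linarith

lemma weylRep_sub_mem_weightFil {ρ σ : ℕ} {m n : ℤ} {z : WeylAlgebra K}
    {g : MvPolynomial (Fin 2) K} (hz : weylSymbol K z ∈ weightFil K ρ σ m)
    (hg : g ∈ weightFil K ρ σ n) :
    weylRep K z g - weylSymbol K z * g + pderiv 1 (weylSymbol K z) * pderiv 0 g ∈
      weightFil K ρ σ (m + n - 2 * (ρ + σ)) := by
  conv in weylRep K z => rw [← ofSymbol_weylSymbol z]
  refine weightFil_induction (P := fun f => weylRep K (ofSymbol K f) g - f * g +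
    pderiv 1 f * pderiv 0 g ∈ weightFil K ρ σ (m + n - 2 * (ρ + σ))) (by simp)
    (fun f₁ f₂ h₁ h₂ => ?_) (fun d c hd => ?_) hz
  · convert add_mem h₁ h₂ using 1
    simp only [map_add, LinearMap.add_apply]; ring
  · have hd' : monomial d c = c • (X 0 ^ d 0 * X 1 ^ d 1 : MvPolynomial (Fin 2) K) := by
      rw [X_pow_eq_monomial, X_pow_eq_monomial, monomial_mul, smul_monomial]
      have : d = Finsupp.single 0 (d 0) + Finsupp.single 1 (d 1) := by
        ext i; fin_cases i <;> simp
      rw [← this]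
      simp
    have e : weylRep K (ofSymbol K (monomial d c)) g - monomial d c * g +
        pderiv 1 (monomial d c) * pderiv 0 g = c • (X 0 ^ d 0 * ((qAction K ^ d 1) g -
          X 1 ^ d 1 * g + pderiv 1 (X 1 ^ d 1) * pderiv 0 g)) := by
      rw [ofSymbol_monomial, hd', Wmono]
      simp only [map_smul, map_mul, LinearMap.smul_apply, Module.End.mul_apply, weylRep_Wp_pow]
      rw [map_pow (weylRep K) (Wq K), weylRep_Wq]
      simp [smul_eq_C_mul]
      ring
    rw [e]
    refine Submodule.smul_mem _ _ (weightFil_mono ?_ (mul_mem_weightFil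
      (X_zero_pow_mem_weightFil ρ σ _) (qAction_pow_sub_mem_weightFil _ hg)))
    push_cast at hd
    linarith

lemma weylSymbol_mul_mem_weightFil {ρ σ : ℕ} {m n : ℤ} {y z : WeylAlgebra K}
    (hy : weylSymbol K y ∈ weightFil K ρ σ m) (hz : weylSymbol K z ∈ weightFil K ρ σ n) :
    weylSymbol K (y * z) ∈ weightFil K ρ σ (m + n) := by
  have h1 := weylRep_sub_mem_weightFil hy hz
  have h2 := mul_mem_weightFil hy hz
  have h3 := mul_mem_weightFil (pderiv_one_mem_weightFil hy) (pderiv_zero_mem_weightFil hz)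
  rw [weylSymbol_mul]
  convert sub_mem (add_mem (weightFil_mono (by omega) h1) h2) (weightFil_mono (by omega) h3)
    using 1
  ring

/-- To leading order, the symbol of a commutator is the Poisson bracket of the symbols. -/
lemma weylSymbol_commutator_sub_mem_weightFil {ρ σ : ℕ} {m n : ℤ} {y z : WeylAlgebra K}
    (hy : weylSymbol K y ∈ weightFil K ρ σ m) (hz : weylSymbol K z ∈ weightFil K ρ σ n) :
    weylSymbol K (y * z - z * y) - poisson (weylSymbol K y) (weylSymbol K z) ∈
      weightFil K ρ σ (m + n - 2 * (ρ + σ)) := by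
  have h1 := weylRep_sub_mem_weightFil hy hz
  have h2 := weylRep_sub_mem_weightFil hz hy
  rw [add_comm n m] at h2
  rw [map_sub, weylSymbol_mul, weylSymbol_mul]
  convert sub_mem h1 h2 using 1
  rw [poisson]; ring

end WeylSymbol

section Commutators

variable {A : Type*} [Ring A]

lemma neg_commutator (a b : A) : -a * b - b * -a = b * a - a * b := by
  noncomm_ring

lemma commutator_neg (a b : A) : a * -b - -b * a = b * a - a * b := by
  noncomm_ring

lemma mul_pow_succ_sub_of_commutator_eq_one {u v : A} (h : u * v - v * u = 1) (j : ℕ) :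
    u * v ^ (j + 1) - v ^ (j + 1) * u = (j + 1 : ℕ) * v ^ j := by
  induction j with
  | zero => simpa using h
  | succ j ih =>
    have e : u * v ^ (j + 1 + 1) - v ^ (j + 1 + 1) * u =
        (u * v ^ (j + 1) - v ^ (j + 1) * u) * v + v ^ (j + 1) * (u * v - v * u) := by
      rw [pow_succ v (j + 1)]; noncomm_ring
    rw [e, ih, h, mul_assoc, ← pow_succ, mul_one]
    push_cast
    rw [add_mul ((j : A) + 1), one_mul]

lemma commutator_sum_mul_pow {u v : A} (h : u * v - v * u = 1) {a : ℕ → A}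
    (ha : ∀ j, u * a j = a j * u) (n : ℕ) :
    u * (∑ j ∈ Finset.range (n + 1), a j * v ^ j) -
      (∑ j ∈ Finset.range (n + 1), a j * v ^ j) * u =
      ∑ j ∈ Finset.range n, (a (j + 1) * (j + 1 : ℕ)) * v ^ j := by
  rw [Finset.mul_sum, Finset.sum_mul, ← Finset.sum_sub_distrib, Finset.sum_range_succ']
  simp only [pow_zero, mul_one, ha 0, sub_self, add_zero]
  refine Finset.sum_congr rfl fun j _ => ?_
  rw [← mul_assoc, ha, mul_assoc, mul_assoc, ← mul_sub, mul_pow_succ_sub_of_commutator_eq_one h,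
    mul_assoc]

lemma commute_mul_natCast {u : A} {a : ℕ → A} (ha : ∀ j, u * a j = a j * u) (j : ℕ) :
    u * (a (j + 1) * (j + 1 : ℕ)) = a (j + 1) * (j + 1 : ℕ) * u := by
  rw [← mul_assoc, ha, mul_assoc, mul_assoc, (Nat.cast_commute (j + 1) u).eq]

lemma eq_zero_of_sum_mul_pow_eq_zero {K : Type*} [Field K] [CharZero K] [Algebra K A] {u v : A}
    (h : u * v - v * u = 1) {n : ℕ} {a : ℕ → A} (ha : ∀ j, u * a j = a j * u)
    (hs : ∑ j ∈ Finset.range n, a j * v ^ j = 0) : ∀ j < n, a j = 0 := by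
  induction n generalizing a with
  | zero => intro j hj; omega
  | succ n ih =>
    have hD := commutator_sum_mul_pow h ha n
    rw [hs, mul_zero, zero_mul, sub_zero] at hD
    have hsucc : ∀ j < n, a (j + 1) = 0 := by
      intro j hj
      have h0 := ih (commute_mul_natCast ha) hD.symm j hj
      have h1 : ((j + 1 : ℕ) : K) • a (j + 1) = 0 := by
        rw [Nat.cast_smul_eq_nsmul, nsmul_eq_mul, (Nat.cast_commute (j + 1) (a (j + 1))).eq, h0]
      exact (smul_eq_zero.1 h1).resolve_left (Nat.cast_ne_zero.2 (Nat.succ_ne_zero j))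
    intro j hj
    cases j with
    | succ j => exact hsucc j (by omega)
    | zero =>
      rw [Finset.sum_range_succ', Finset.sum_eq_zero fun j hj => by
        rw [hsucc j (Finset.mem_range.1 hj), zero_mul]] at hs
      simpa using hs

lemma iterate_commutator_sum_mul_pow {u v : A} (h : u * v - v * u = 1) (n : ℕ) {a : ℕ → A}
    (ha : ∀ j, u * a j = a j * u) :
    (fun z => u * z - z * u)^[n] (∑ j ∈ Finset.range n, a j * v ^ j) = 0 := by
  induction n generalizing a with
  | zero => simp
  | succ n ih =>
    rw [Function.iterate_succ_apply, commutator_sum_mul_pow h ha]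
    exact ih (commute_mul_natCast ha)

end Commutators

section Edges

open MvPolynomial

variable {K : Type*} [Field K]

lemma exists_topPart_ne_zero {ρ σ : ℕ} (hσ : 0 < σ) {M : ℕ} {f : MvPolynomial (Fin 2) K}
    (hf : f ≠ 0) (hM : f ∈ weightFil K ρ σ M) :
    ∃ n ≤ M, f ∈ weightFil K ρ σ n ∧ topPart K ρ σ n f ≠ 0 := by
  obtain ⟨d, hd, hmax⟩ := f.support.exists_max_image (fun d => d 0 * ρ + d 1 * σ)
    (support_nonempty.2 hf)
  refine ⟨d 0 * ρ + d 1 * σ, by exact_mod_cast hM hd,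
    fun e he => by exact_mod_cast hmax e he, fun h => ?_⟩
  have := coeff_topPart hσ f (d := d) (ρ := ρ) rfl
  rw [h, Polynomial.coeff_zero] at this
  exact mem_support_iff.1 hd this.symm

lemma weylSymbol_one_mem_weightFil (ρ σ : ℕ) :
    weylSymbol K (1 : WeylAlgebra K) ∈ weightFil K ρ σ 0 := by
  rw [weylSymbol_apply, map_one (weylRep K), Module.End.one_apply, ← C_1, C_apply]
  exact monomial_mem_weightFil _ (by simp)

lemma weylSymbol_pow_mem_weightFil {ρ σ m : ℕ} {x : WeylAlgebra K}
    (hx : weylSymbol K x ∈ weightFil K ρ σ m) (i : ℕ) :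
    weylSymbol K (x ^ i) ∈ weightFil K ρ σ ((i * m : ℕ) : ℤ) := by
  induction i with
  | zero => simpa using weylSymbol_one_mem_weightFil (K := K) ρ σ
  | succ i ih =>
    rw [pow_succ]
    convert weylSymbol_mul_mem_weightFil ih hx using 1
    push_cast; ring_nf

lemma exists_mem_weightFil (ρ σ : ℕ) (f : MvPolynomial (Fin 2) K) :
    ∃ w : ℕ, f ∈ weightFil K ρ σ w :=
  ⟨f.support.sup fun d => d 0 * ρ + d 1 * σ, fun d hd => by
    exact_mod_cast Finset.le_sup (f := fun d : Fin 2 →₀ ℕ => d 0 * ρ + d 1 * σ) hd⟩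

/-- If `[x, y] = 1`, some element killed by a power of `ad x` has a leading form which does not
Poisson-commute with the leading form of `x`. -/
lemma exists_wtWronskian_ne_zero [CharZero K] {ρ σ v : ℕ} (hσ : 0 < σ) (hv : 0 < v)
    {x y : WeylAlgebra K} (hxy : x * y - y * x = 1) (hx : weylSymbol K x ∈ weightFil K ρ σ v)
    (hp : topPart K ρ σ v (weylSymbol K x) ≠ 0) :
    ∃ (k : ℕ) (z : WeylAlgebra K) (n : ℕ), weylSymbol K z ∈ weightFil K ρ σ n ∧
      wtWronskian n v (topPart K ρ σ v (weylSymbol K x)) (topPart K ρ σ n (weylSymbol K z)) ≠ 0 ∧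
      (fun z => x * z - z * x)^[k] z = 0 := by
  set p := topPart K ρ σ v (weylSymbol K x) with hp_def
  obtain ⟨w, hy⟩ := exists_mem_weightFil ρ σ (weylSymbol K y)
  set N := v + w with hN
  let Z : (Fin (N + 1) × Fin (N + 1) → K) →ₗ[K] WeylAlgebra K :=
    Fintype.linearCombination K fun ij => x ^ (ij.1 : ℕ) * y ^ (ij.2 : ℕ)
  let Φ : (Fin (N + 1) × Fin (N + 1) → K) →ₗ[K] (Fin (N * N + 1) → K) :=
    LinearMap.pi fun n => (Polynomial.lcoeff K (n * p.natDegree / v)).comp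
      ((topPart K ρ σ (n : ℕ)).comp ((weylSymbol K).comp Z))
  obtain ⟨c, hc, hc0⟩ : ∃ c, Φ c = 0 ∧ c ≠ 0 := by
    have h : LinearMap.ker Φ ≠ ⊥ := LinearMap.ker_ne_bot_of_finrank_lt (by
      simp only [Module.finrank_pi, Fintype.card_prod, Fintype.card_fin]
      nlinarith)
    obtain ⟨c, hc, hc0⟩ := Submodule.exists_mem_ne_zero_of_ne_bot h
    exact ⟨c, hc, hc0⟩
  let a : ℕ → WeylAlgebra K := fun j => if hj : j < N + 1 then
    ∑ i : Fin (N + 1), c (i, ⟨j, hj⟩) • x ^ (i : ℕ) else 0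
  have hZ : Z c = ∑ j ∈ Finset.range (N + 1), a j * y ^ j := by
    rw [Finset.sum_range, Fintype.linearCombination_apply, Fintype.sum_prod_type_right]
    refine Finset.sum_congr rfl fun j _ => ?_
    simp only [a, j.2, dif_pos, Finset.sum_mul, smul_mul_assoc]
  have ha : ∀ j, x * a j = a j * x := by
    intro j
    simp only [a]
    split_ifs
    · rw [Finset.mul_sum, Finset.sum_mul]
      refine Finset.sum_congr rfl fun i _ => ?_
      rw [mul_smul_comm, smul_mul_assoc, ← pow_succ, ← pow_succ']
    · simp
  have : Nontrivial (WeylAlgebra K) := by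
    refine ⟨x, 0, fun h => hp ?_⟩
    rw [hp_def, h, map_zero, map_zero]
  have hZ0 : Z c ≠ 0 := by
    intro h0
    refine hc0 (funext fun ⟨i, j⟩ => ?_)
    have haj := eq_zero_of_sum_mul_pow_eq_zero (K := K) hxy ha (hZ.symm.trans h0) j j.2
    simp only [a, j.2, dif_pos] at haj
    let b : ℕ → WeylAlgebra K := fun i => if hi : i < N + 1 then
      algebraMap K _ (c (⟨i, hi⟩, j)) else 0
    have hb : ∑ i ∈ Finset.range (N + 1), b i * x ^ i = 0 := by
      rw [Finset.sum_range, ← haj]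
      refine Finset.sum_congr rfl fun i _ => ?_
      simp only [b, i.2, dif_pos, Algebra.smul_def]
    have hbc : ∀ i, (-y) * b i = b i * (-y) := by
      intro i
      simp only [b]
      split_ifs
      · exact (Algebra.commutes _ _).symm
      · simp
    have h1 := eq_zero_of_sum_mul_pow_eq_zero (K := K) (u := -y) (v := x)
      ((neg_commutator y x).trans hxy) hbc hb i i.2
    simp only [b, i.2, dif_pos] at h1
    simpa using (map_eq_zero_iff _ (algebraMap K (WeylAlgebra K)).injective).1 h1
  have hZM : weylSymbol K (Z c) ∈ weightFil K ρ σ ((N * N : ℕ) : ℤ) := by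
    rw [Fintype.linearCombination_apply, map_sum]
    refine sum_mem fun ij _ => ?_
    rw [map_smul]
    refine Submodule.smul_mem _ _ (weightFil_mono ?_ (weylSymbol_mul_mem_weightFil
      (weylSymbol_pow_mem_weightFil hx _) (weylSymbol_pow_mem_weightFil hy _)))
    norm_cast
    have h1 : (ij.1 : ℕ) ≤ N := by omega
    have h2 : (ij.2 : ℕ) ≤ N := by omega
    calc _ ≤ N * v + N * w := by gcongr
      _ = N * N := by rw [← mul_add]
  obtain ⟨n, hnM, hn, hn0⟩ := exists_topPart_ne_zero hσ (weylSymbol_ne_zero hZ0) hZM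
  refine ⟨N + 1, Z c, n, hn, fun hW => hn0 ?_, hZ ▸ iterate_commutator_sum_mul_pow hxy _ ha⟩
  have hdeg := mul_natDegree_of_wtWronskian_eq_zero hp hn0 hW
  have h1 := congrFun hc ⟨n, by omega⟩
  simp only [Φ, LinearMap.pi_apply, LinearMap.comp_apply, Polynomial.lcoeff_apply,
    Pi.zero_apply] at h1
  rwa [hdeg, Nat.mul_div_cancel_left _ hv, Polynomial.coeff_natDegree,
    Polynomial.leadingCoeff_eq_zero] at h1

lemma supportedInWeight_topPart (ρ σ n : ℕ) (f : MvPolynomial (Fin 2) K) :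
    SupportedInWeight ρ σ n (topPart K ρ σ n f) := by
  intro i hi
  obtain ⟨d, -, rfl, h⟩ := exists_of_mem_support_topPart hi
  exact ⟨d 1, by exact_mod_cast h⟩

lemma poisson_mem_weightFil {ρ σ : ℕ} {m n : ℤ} {f g : MvPolynomial (Fin 2) K}
    (hf : f ∈ weightFil K ρ σ m) (hg : g ∈ weightFil K ρ σ n) :
    poisson f g ∈ weightFil K ρ σ (m + n - ρ - σ) :=
  sub_mem
    (weightFil_mono (by linarith)
      (mul_mem_weightFil (pderiv_zero_mem_weightFil hf) (pderiv_one_mem_weightFil hg)))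
    (weightFil_mono (by linarith)
      (mul_mem_weightFil (pderiv_one_mem_weightFil hf) (pderiv_zero_mem_weightFil hg)))

lemma exists_wtWronskian_eq_topPart_commutator {ρ σ v n : ℕ} (hσ : 0 < σ) {x z : WeylAlgebra K}
    (hx : weylSymbol K x ∈ weightFil K ρ σ v) (hz : weylSymbol K z ∈ weightFil K ρ σ n)
    (hW : wtWronskian n v (topPart K ρ σ v (weylSymbol K x))
      (topPart K ρ σ n (weylSymbol K z)) ≠ 0) :
    ∃ w : ℕ, w + ρ + σ = v + n ∧ weylSymbol K (x * z - z * x) ∈ weightFil K ρ σ w ∧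
      topPart K ρ σ w (weylSymbol K (x * z - z * x)) ≠ 0 ∧
      wtWronskian n v (topPart K ρ σ v (weylSymbol K x)) (topPart K ρ σ n (weylSymbol K z)) =
        Polynomial.C (σ : K) * topPart K ρ σ w (weylSymbol K (x * z - z * x)) := by
  have hdiff := weylSymbol_commutator_sub_mem_weightFil hx hz
  have hh : wtWronskian n v (topPart K ρ σ v (weylSymbol K x)) (topPart K ρ σ n (weylSymbol K z)) =
      Polynomial.C (σ : K) * topPart K ρ σ (v + n - ρ - σ) (weylSymbol K (x * z - z * x)) := by
    rw [wtWronskian, ← topPart_poisson hx hz, eq_comm, ← sub_eq_zero, ← mul_sub, ← map_sub,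
      topPart_eq_zero (by omega) hdiff, mul_zero]
  have hh0 : topPart K ρ σ (v + n - ρ - σ) (weylSymbol K (x * z - z * x)) ≠ 0 := by
    intro h0
    rw [hh, h0, mul_zero] at hW
    exact hW rfl
  obtain ⟨d, -, -, hd⟩ := exists_of_mem_support_topPart
    (Polynomial.natDegree_mem_support_of_nonzero hh0)
  have hw : ((d 0 * ρ + d 1 * σ : ℕ) : ℤ) = v + n - ρ - σ := by push_cast; exact hd
  refine ⟨d 0 * ρ + d 1 * σ, by omega, ?_, by rwa [hw], by rwa [hw]⟩
  rw [hw, ← sub_add_cancel (weylSymbol K (x * z - z * x))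
    (poisson (weylSymbol K x) (weylSymbol K z))]
  exact add_mem (weightFil_mono (by omega) hdiff) (poisson_mem_weightFil hx hz)

/-- An edge of a solvable element that does not reach the `p`-axis has `σ = 1`. -/
lemma Solvable.sigma_eq_one [CharZero K] {ρ σ v : ℕ} (hρ : 0 < ρ) (hσ : 0 < σ)
    (hco : Nat.Coprime ρ σ) {x : WeylAlgebra K} (hsol : Solvable K x)
    (hx : weylSymbol K x ∈ weightFil K ρ σ v)
    (hcard : 1 < (topPart K ρ σ v (weylSymbol K x)).support.card)
    (hdeg : (topPart K ρ σ v (weylSymbol K x)).natDegree * ρ < v) : σ = 1 := by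
  classical
  obtain ⟨y, hxy⟩ := hsol
  have hp : topPart K ρ σ v (weylSymbol K x) ≠ 0 := by
    intro h
    simp [h] at hcard
  have hex := exists_wtWronskian_ne_zero hσ (by omega) hxy hx hp
  obtain ⟨k, ⟨z, n, hz, hW, hk⟩, hmin⟩ :
      ∃ k, (∃ (z : WeylAlgebra K) (n : ℕ), weylSymbol K z ∈ weightFil K ρ σ n ∧
        wtWronskian n v (topPart K ρ σ v (weylSymbol K x))
          (topPart K ρ σ n (weylSymbol K z)) ≠ 0 ∧ (fun z => x * z - z * x)^[k] z = 0) ∧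
      ∀ m < k, ¬ ∃ (z : WeylAlgebra K) (n : ℕ), weylSymbol K z ∈ weightFil K ρ σ n ∧
        wtWronskian n v (topPart K ρ σ v (weylSymbol K x))
          (topPart K ρ σ n (weylSymbol K z)) ≠ 0 ∧ (fun z => x * z - z * x)^[m] z = 0 :=
    ⟨Nat.find hex, Nat.find_spec hex, fun m hm => Nat.find_min hex hm⟩
  cases k with
  | zero =>
    have hk : z = 0 := hk
    simp [hk, wtWronskian] at hW
  | succ k =>
    rw [Function.iterate_succ_apply] at hk
    obtain ⟨w, h1, h2, h3, h4⟩ := exists_wtWronskian_eq_topPart_commutator hσ hx hz hW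
    refine sigma_eq_one_of_wtWronskian hρ hco hp (fun h0 => ?_) h3 (Nat.cast_ne_zero.2 hσ.ne')
      (by omega) h4 (not_not.1 fun hne => hmin k k.lt_succ_self ⟨_, w, h2, hne, hk⟩)
      (supportedInWeight_topPart ρ σ v _) (supportedInWeight_topPart ρ σ n _)
      (supportedInWeight_topPart ρ σ w _) hdeg hcard
    simp [h0, wtWronskian] at hW

lemma coeff_weylSymbol_of_represents {α : (ℕ × ℕ) →₀ K} {x : WeylAlgebra K}
    (h : Represents K α x) (d : Fin 2 →₀ ℕ) : coeff d (weylSymbol K x) = α (d 0, d 1) := by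
  classical
  rw [h, Finsupp.sum, map_sum, coeff_sum]
  have hiff : ∀ ij : ℕ × ℕ, (Finsupp.single 0 ij.1 + Finsupp.single 1 ij.2 = d) ↔
      ij = (d 0, d 1) := by
    rintro ⟨i, j⟩
    constructor
    · rintro rfl
      simp
    · rintro ⟨⟩
      ext i; fin_cases i <;> simp
  simp only [map_smul, weylSymbol_Wmono, coeff_smul, coeff_monomial, hiff, smul_eq_mul, mul_ite,
    mul_one, mul_zero, Finset.sum_ite_eq', Finsupp.mem_support_iff]
  split_ifs with h0
  · rfl
  · exact (not_not.1 h0).symm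

lemma Solvable.sigma_eq_one_of_represents [CharZero K] {ρ σ v : ℕ} (hρ : 0 < ρ) (hσ : 0 < σ)
    (hco : Nat.Coprime ρ σ) {x : WeylAlgebra K} (hsol : Solvable K x) {α : (ℕ × ℕ) →₀ K}
    (h : Represents K α x) (hle : ∀ ij ∈ α.support, ij.1 * ρ + ij.2 * σ ≤ v)
    (hpos : ∀ ij ∈ α.support, ij.1 * ρ + ij.2 * σ = v → 0 < ij.2)
    {a b : ℕ × ℕ} (ha : a ∈ α.support) (hb : b ∈ α.support) (hab : a ≠ b)
    (hav : a.1 * ρ + a.2 * σ = v) (hbv : b.1 * ρ + b.2 * σ = v) : σ = 1 := by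
  have hmem : ∀ ij ∈ α.support, ij.1 * ρ + ij.2 * σ = v →
      ij.1 ∈ (topPart K ρ σ v (weylSymbol K x)).support := by
    intro ij hij hijv
    rw [Polynomial.mem_support_iff]
    have := coeff_topPart hσ (ρ := ρ) (n := v) (weylSymbol K x)
      (d := Finsupp.single 0 ij.1 + Finsupp.single 1 ij.2) (by simp [← hijv])
    simp only [coeff_weylSymbol_of_represents h] at this
    simp at this
    rw [this]
    exact Finsupp.mem_support_iff.1 hij
  have hsupp : ∀ d ∈ (weylSymbol K x).support, (d 0, d 1) ∈ α.support := by
    intro d hd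
    rw [Finsupp.mem_support_iff, ← coeff_weylSymbol_of_represents h]
    exact mem_support_iff.1 hd
  refine hsol.sigma_eq_one (v := v) hρ hσ hco (fun d hd => ?_) (Finset.one_lt_card.2
    ⟨a.1, hmem a ha hav, b.1, hmem b hb hbv, fun h1 => hab ?_⟩) ?_
  · exact_mod_cast hle _ (hsupp d hd)
  · refine Prod.ext h1 (Nat.eq_of_mul_eq_mul_right hσ ?_)
    rw [h1] at hav
    omega
  · have h0 : topPart K ρ σ v (weylSymbol K x) ≠ 0 := by
      intro h0
      simpa [h0] using hmem a ha hav
    obtain ⟨d, hd, hd0, hdv⟩ := exists_of_mem_support_topPart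
      (Polynomial.natDegree_mem_support_of_nonzero h0)
    norm_cast at hdv
    have := Nat.mul_pos (hpos _ (hsupp d hd) hdv) hσ
    rw [← hd0]
    dsimp only at this
    omega

/-- The anti-automorphism of the Weyl algebra exchanging `p` and `q`. -/
noncomputable def weylSwap (K : Type*) [Field K] : WeylAlgebra K →ₐ[K] (WeylAlgebra K)ᵐᵒᵖ :=
  RingQuot.liftAlgHom K ⟨FreeAlgebra.lift K ![MulOpposite.op (Wq K), MulOpposite.op (Wp K)], by
    rintro _ _ ⟨⟩
    simp [← MulOpposite.op_mul, Wp_mul_Wq]⟩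

lemma weylSwap_Wp : weylSwap K (Wp K) = MulOpposite.op (Wq K) := by
  exact (RingQuot.liftAlgHom_mkAlgHom_apply ..).trans (by rw [FreeAlgebra.lift_ι_apply]; rfl)

lemma weylSwap_Wq : weylSwap K (Wq K) = MulOpposite.op (Wp K) := by
  exact (RingQuot.liftAlgHom_mkAlgHom_apply ..).trans (by rw [FreeAlgebra.lift_ι_apply]; rfl)

lemma weylSwap_Wmono (i j : ℕ) : weylSwap K (Wmono K i j) = MulOpposite.op (Wmono K j i) := by
  simp [Wmono, weylSwap_Wp, weylSwap_Wq]

lemma Represents.weylSwap {α : (ℕ × ℕ) →₀ K} {x : WeylAlgebra K} (h : Represents K α x) :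
    Represents K (α.equivMapDomain (Equiv.prodComm ℕ ℕ)) (weylSwap K x).unop := by
  rw [Represents, Finsupp.sum_equivMapDomain]
  refine MulOpposite.op_injective ?_
  conv_lhs => rw [h]
  simp [Finsupp.sum, weylSwap_Wmono, Finset.op_sum]

lemma Solvable.weylSwap {x : WeylAlgebra K} (h : Solvable K x) :
    Solvable K (weylSwap K x).unop := by
  obtain ⟨y, hy⟩ := h
  refine ⟨-(_root_.weylSwap K y).unop, ?_⟩
  have := congrArg (fun z => (_root_.weylSwap K z).unop) hy
  simp at this
  exact (commutator_neg _ _).trans this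

/-- An edge of a solvable element that does not reach the `q`-axis has `ρ = 1`. -/
lemma Solvable.rho_eq_one_of_represents [CharZero K] {ρ σ v : ℕ} (hρ : 0 < ρ) (hσ : 0 < σ)
    (hco : Nat.Coprime ρ σ) {x : WeylAlgebra K} (hsol : Solvable K x) {α : (ℕ × ℕ) →₀ K}
    (h : Represents K α x) (hle : ∀ ij ∈ α.support, ij.1 * ρ + ij.2 * σ ≤ v)
    (hpos : ∀ ij ∈ α.support, ij.1 * ρ + ij.2 * σ = v → 0 < ij.1)
    {a b : ℕ × ℕ} (ha : a ∈ α.support) (hb : b ∈ α.support) (hab : a ≠ b)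
    (hav : a.1 * ρ + a.2 * σ = v) (hbv : b.1 * ρ + b.2 * σ = v) : ρ = 1 := by
  have hsupp : ∀ ij : ℕ × ℕ, ij ∈ (α.equivMapDomain (Equiv.prodComm ℕ ℕ)).support ↔
      ij.swap ∈ α.support := by
    intro ij
    rw [Finsupp.mem_support_iff, Finsupp.mem_support_iff, Finsupp.equivMapDomain_apply]
    rfl
  refine hsol.weylSwap.sigma_eq_one_of_represents (v := v) hσ hρ hco.symm h.weylSwap
    (fun ij hij => ?_) (fun ij hij hv => ?_) ((hsupp a.swap).2 (by simpa using ha))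
    ((hsupp b.swap).2 (by simpa using hb)) (fun h => hab (Prod.swap_injective h)) ?_ ?_
  · rw [add_comm]; exact hle _ ((hsupp ij).1 hij)
  · exact hpos _ ((hsupp ij).1 hij) (by rw [← hv, add_comm]; rfl)
  · rw [← hav, add_comm]; rfl
  · rw [← hbv, add_comm]; rfl

/-- An edge is kept off the `p`-axis by an adjacent edge of larger slope `ρ/σ`. -/
lemma snd_pos_of_adjacent {S : Set (ℕ × ℕ)} {ρ₁ σ₁ ρ₂ σ₂ v₁ v₂ : ℕ}
    (hρ₁ : 0 < ρ₁) (hρ₂ : 0 < ρ₂)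
    (hlt : ρ₁ * σ₂ < ρ₂ * σ₁) (hle₁ : ∀ ij ∈ S, ij.1 * ρ₁ + ij.2 * σ₁ ≤ v₁)
    (hle₂ : ∀ ij ∈ S, ij.1 * ρ₂ + ij.2 * σ₂ ≤ v₂)
    {B C : ℕ × ℕ} (hB : B ∈ S) (hB₁ : B.1 * ρ₁ + B.2 * σ₁ = v₁) (hB₂ : B.1 * ρ₂ + B.2 * σ₂ = v₂)
    (hC : C ∈ S) (hC₂ : C.1 * ρ₂ + C.2 * σ₂ = v₂) (hBC : C ≠ B) {D : ℕ × ℕ} (hD : D ∈ S)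
    (hD₁ : D.1 * ρ₁ + D.2 * σ₁ = v₁) : 0 < D.2 := by
  obtain ⟨a, b⟩ := B
  obtain ⟨k, l⟩ := C
  obtain ⟨i, j⟩ := D
  have h1 := hle₂ _ hD
  have h2 := hle₁ _ hC
  rw [Nat.pos_iff_ne_zero]
  rintro hj
  simp only at *
  subst hj hB₁ hB₂
  zify at *
  have hb : b = 0 := by
    by_contra hb
    have hb : (0 : ℤ) < b := by omega
    have e1 : ((i : ℤ) - a) * ρ₁ = b * σ₁ := by linarith
    have e2 : ((i : ℤ) - a) * ρ₂ ≤ b * σ₂ := by linarith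
    nlinarith [mul_le_mul_of_nonneg_right e2 hρ₁.le, mul_lt_mul_of_pos_left hlt hb]
  subst hb
  have hl : (0 : ℤ) < l := by
    by_contra hl
    have hl : (l : ℤ) = 0 := by omega
    simp only [hl, Nat.cast_zero, zero_mul, add_zero] at hC₂
    have := mul_right_cancel₀ hρ₂.ne' hC₂
    exact hBC (Prod.ext (by exact_mod_cast this) (by exact_mod_cast hl))
  have e1 : ((a : ℤ) - k) * ρ₂ = l * σ₂ := by push_cast at *; linarith
  have e2 : (l : ℤ) * σ₁ ≤ (a - k) * ρ₁ := by push_cast at *; linarith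
  nlinarith [mul_le_mul_of_nonneg_right e2 hρ₂.le, mul_lt_mul_of_pos_left hlt hl]

lemma not_adjacent_edges [CharZero K] {x : WeylAlgebra K} {α : (ℕ × ℕ) →₀ K}
    (hrep : Represents K α x) (hsol : Solvable K x)
    {ρ₁ σ₁ ρ₂ σ₂ : ℕ} (hρ₁ : 0 < ρ₁) (hσ₁ : 0 < σ₁) (hρ₂ : 0 < ρ₂) (hσ₂ : 0 < σ₂)
    (hco₁ : Nat.Coprime ρ₁ σ₁) (hco₂ : Nat.Coprime ρ₂ σ₂) (hlt : ρ₁ * σ₂ < ρ₂ * σ₁)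
    (he₁ : 1 < (Eset K α ρ₁ σ₁).card) (he₂ : 1 < (Eset K α ρ₂ σ₂).card)
    (hadj : (Eset K α ρ₁ σ₁ ∩ Eset K α ρ₂ σ₂).card = 1) : False := by
  classical
  have hle : ∀ ρ σ : ℕ, ∀ ij ∈ α.support, ij.1 * ρ + ij.2 * σ ≤ vdeg K α ρ σ := fun ρ σ ij hij =>
    Finset.le_sup (f := fun ij : ℕ × ℕ => ij.1 * ρ + ij.2 * σ) hij
  have hmem : ∀ {ρ σ : ℕ} {ij : ℕ × ℕ}, ij ∈ Eset K α ρ σ ↔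
      ij ∈ α.support ∧ ij.1 * ρ + ij.2 * σ = vdeg K α ρ σ := Finset.mem_filter
  obtain ⟨B, hB⟩ := Finset.card_pos.1 (hadj ▸ Nat.one_pos)
  rw [Finset.mem_inter] at hB
  obtain ⟨C₁, hC₁, hBC₁⟩ := Finset.exists_mem_ne he₁ B
  obtain ⟨C₂, hC₂, hBC₂⟩ := Finset.exists_mem_ne he₂ B
  have hB₁ := hmem.1 hB.1
  have hB₂ := hmem.1 hB.2
  rw [hmem] at hC₁ hC₂
  have h1 : σ₁ = 1 := hsol.sigma_eq_one_of_represents hρ₁ hσ₁ hco₁ hrep (hle ρ₁ σ₁)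
    (fun ij hij hv => snd_pos_of_adjacent (S := {ij | ij ∈ α.support}) hρ₁ hρ₂ hlt
      (hle ρ₁ σ₁) (hle ρ₂ σ₂) hB₁.1 hB₁.2 hB₂.2 hC₂.1 hC₂.2 hBC₂ hij hv)
    hC₁.1 hB₁.1 hBC₁ hC₁.2 hB₁.2
  have h2 : ρ₂ = 1 := by
    refine hsol.rho_eq_one_of_represents hρ₂ hσ₂ hco₂ hrep (hle ρ₂ σ₂)
      (fun ij hij hv => ?_) hC₂.1 hB₂.1 hBC₂ hC₂.2 hB₂.2
    refine snd_pos_of_adjacent (S := {ij | ij.swap ∈ α.support}) (B := B.swap) (C := C₁.swap)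
      (D := ij.swap) (σ₁ := ρ₂) (σ₂ := ρ₁) (v₁ := vdeg K α ρ₂ σ₂) (v₂ := vdeg K α ρ₁ σ₁) hσ₂ hσ₁
      (by rwa [mul_comm σ₂, mul_comm σ₁])
      (fun ij hij => ?_) (fun ij hij => ?_) (by simpa using hB₁.1) ?_ ?_ (by simpa using hC₁.1)
      ?_ (fun h => hBC₁ (Prod.swap_injective h)) (by simpa using hij) ?_
    · rw [add_comm]; exact hle ρ₂ σ₂ _ hij
    · rw [add_comm]; exact hle ρ₁ σ₁ _ hij
    · rw [add_comm]; exact hB₂.2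
    · rw [add_comm]; exact hB₁.2
    · rw [add_comm]; exact hC₁.2
    · rw [add_comm]; exact hv
  rw [h1, h2] at hlt
  have := Nat.mul_pos hρ₁ hσ₂
  omega

end Edges

/-- Lemma 5.5. -/
theorem gcd_exponents_gt_one_of_adjacent_edges (x : WeylAlgebra F) (α : (ℕ × ℕ) →₀ F)
    (hrep : Represents F α x) (hsol : Solvable F x)
    (hvall : ∀ ρ σ : ℕ, 0 < ρ → 0 < σ → Nat.Coprime ρ σ → ρ + σ ≤ vdeg F α ρ σ)
    (ρ₁ σ₁ ρ₂ σ₂ : ℕ) (hρ₁ : 0 < ρ₁) (hσ₁ : 0 < σ₁) (hρ₂ : 0 < ρ₂) (hσ₂ : 0 < σ₂)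
    (hco₁ : Nat.Coprime ρ₁ σ₁) (hco₂ : Nat.Coprime ρ₂ σ₂)
    (hlt : ρ₁ * σ₂ < ρ₂ * σ₁)
    (he₁ : 1 < (Eset F α ρ₁ σ₁).card) (he₂ : 1 < (Eset F α ρ₂ σ₂).card)
    (hadj : (Eset F α ρ₁ σ₁ ∩ Eset F α ρ₂ σ₂).card = 1)
    (f₁ f₂ : MvPolynomial (Fin 2) F) (r₁ r₂ : ℕ) (hr₁ : 1 < r₁) (hr₂ : 1 < r₂)
    (hp₁ : wpoly F α ρ₁ σ₁ = f₁ ^ r₁) (hp₂ : wpoly F α ρ₂ σ₂ = f₂ ^ r₂)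
    (hnp₁ : ∀ (κ : MvPolynomial (Fin 2) F) (m : ℕ), 1 < m → f₁ ≠ κ ^ m)
    (hnp₂ : ∀ (κ : MvPolynomial (Fin 2) F) (m : ℕ), 1 < m → f₂ ≠ κ ^ m) :
    1 < Nat.gcd r₁ r₂ := by
  exact (not_adjacent_edges hrep hsol hρ₁ hσ₁ hρ₂ hσ₂ hco₁ hco₂ hlt he₁ he₂ hadj).elim
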